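/- Let d ≥ 1 and α ∈ (0,2). There exists a constant κ₁ > 0, depending only on d and α, such that for all x ∈ ℝ^d with |x| > 1: ⟨x, B(x)⟩ ≤ −κ₁ |x|^{2−d−α}. -/

import Mathlib

open MeasureTheory Real

noncomputable section

/-- `ρ_α(x) = (1+|x|²)^{-(d+α)/2}`. -/
def rhoA (d : ℕ) (α : ℝ) (x : EuclideanSpace ℝ (Fin d)) : ℝ :=
  (1 + ‖x‖ ^ 2) ^ (-(((d : ℝ) + α) / 2))

/-- `c_{d,α} = 2^α Γ((d+α)/2) / (Γ(d/2) Γ((2-α)/2))`. -/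
def cdA (d : ℕ) (α : ℝ) : ℝ :=
  2 ^ α * Real.Gamma (((d : ℝ) + α) / 2)
    / (Real.Gamma ((d : ℝ) / 2) * Real.Gamma ((2 - α) / 2))

/-- `B(x) = c_{d,α} ∫ y (ρ_α(x+y) - ρ_α(x-y)) |y|^{-d-α} dy`. -/
def fieldB (d : ℕ) (α : ℝ) (x : EuclideanSpace ℝ (Fin d)) : EuclideanSpace ℝ (Fin d) :=
  cdA d α • ∫ y : EuclideanSpace ℝ (Fin d),
    ((rhoA d α (x + y) - rhoA d α (x - y)) * ‖y‖ ^ (-(d : ℝ) - α)) • y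


open scoped RealInnerProductSpace


lemma aux_lip (q : ℝ) (hq : 0 ≤ q) (a b : ℝ) (ha : 0 ≤ a) (hb : 0 ≤ b) :
    |(1 + a) ^ (-q) - (1 + b) ^ (-q)| ≤ q * |a - b| := by
  have h := (convex_Ici (0:ℝ)).norm_image_sub_le_of_norm_hasDerivWithin_le
    (f := fun t : ℝ => (1 + t) ^ (-q)) (f' := fun t => 1 * (-q) * (1 + t) ^ (-q - 1)) (C := q)
    (x := b) (y := a) ?_ ?_ hb ha
  · simpa [Real.norm_eq_abs] using h
  · intro t ht
    have ht' : (0:ℝ) ≤ t := ht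
    exact (((hasDerivAt_id t).const_add 1).rpow_const (Or.inl (by simp; linarith))).hasDerivWithinAt
  · intro t ht
    have ht' : (0:ℝ) ≤ t := ht
    have h1 : (1 + t) ^ (-q - 1) ≤ 1 := Real.rpow_le_one_of_one_le_of_nonpos (by linarith) (by linarith)
    have h0 : 0 ≤ (1 + t) ^ (-q - 1) := by positivity
    rw [Real.norm_eq_abs, one_mul, abs_mul, abs_neg, abs_of_nonneg hq, abs_of_nonneg h0]
    nlinarith

lemma aux_diff {d : ℕ} (x y : EuclideanSpace ℝ (Fin d)) :
    ‖x + y‖ ^ 2 - ‖x - y‖ ^ 2 = 4 * ⟪x, y⟫ := by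
  rw [norm_add_sq_real, norm_sub_sq_real]; ring

lemma rhoA_mono {d : ℕ} {α : ℝ} (hα : 0 < α) {x y : EuclideanSpace ℝ (Fin d)}
    (h : ‖x‖ ^ 2 ≤ ‖y‖ ^ 2) : rhoA d α y ≤ rhoA d α x := by
  unfold rhoA
  apply Real.rpow_le_rpow_of_nonpos (by positivity) (by linarith)
  have : (0:ℝ) ≤ d := by positivity
  linarith

lemma rhoA_nonneg (d : ℕ) (α : ℝ) (x : EuclideanSpace ℝ (Fin d)) : 0 ≤ rhoA d α x := by
  unfold rhoA; positivity

lemma rhoA_integrable (d : ℕ) (α : ℝ) (hα : 0 < α) : Integrable (rhoA d α) := by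
  have h := integrable_rpow_neg_one_add_norm_sq (E := EuclideanSpace ℝ (Fin d)) (μ := volume)
    (r := (d:ℝ) + α) (by simp; exact hα)
  refine h.congr (Filter.Eventually.of_forall fun y => ?_)
  simp only [rhoA]; congr 1; ring

lemma rhoA_cont (d : ℕ) (α : ℝ) : Continuous (rhoA d α) := by
  unfold rhoA
  exact (by fun_prop : Continuous fun x : EuclideanSpace ℝ (Fin d) => 1 + ‖x‖ ^ 2).rpow_const
    (fun x => Or.inl (by positivity))

lemma near_integrable (d : ℕ) (hd : 1 ≤ d) (α : ℝ) (hα : α < 2) :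
    Integrable (fun y : EuclideanSpace ℝ (Fin d) =>
      (Set.Ioc (0:ℝ) 1).indicator (fun r => r ^ (2 - (d:ℝ) - α)) ‖y‖) := by
  have : Nonempty (Fin d) := ⟨⟨0, hd⟩⟩
  rw [integrable_fun_norm_addHaar (volume : Measure (EuclideanSpace ℝ (Fin d)))
    (f := (Set.Ioc (0:ℝ) 1).indicator (fun r => r ^ (2 - (d:ℝ) - α)))]
  have h : IntegrableOn (fun r : ℝ => r ^ (1 - α)) (Set.Ioc 0 1) := by
    have := intervalIntegral.intervalIntegrable_rpow' (a := 0) (b := 1) (r := 1 - α) (by linarith)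
    rwa [intervalIntegrable_iff_integrableOn_Ioc_of_le zero_le_one] at this
  have h2 := (integrable_indicator_iff measurableSet_Ioc).2 h
  refine (h2.integrableOn (s := Set.Ioi 0)).congr_fun ?_ measurableSet_Ioi
  intro r hr
  have hr : 0 < r := hr
  by_cases h1 : r ∈ Set.Ioc (0:ℝ) 1
  · simp only [Set.indicator_of_mem h1, finrank_euclideanSpace, Fintype.card_fin, smul_eq_mul]
    rw [← Real.rpow_natCast, ← Real.rpow_add hr]
    congr 1
    push_cast [Nat.cast_sub hd]; ring
  · simp [Set.indicator_of_notMem h1]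

lemma main_integrable (d : ℕ) (hd : 1 ≤ d) (α : ℝ) (hα : α ∈ Set.Ioo (0 : ℝ) 2)
    (x : EuclideanSpace ℝ (Fin d)) :
    Integrable (fun y : EuclideanSpace ℝ (Fin d) =>
      ((rhoA d α (x + y) - rhoA d α (x - y)) * ‖y‖ ^ (-(d : ℝ) - α)) • y) := by
  obtain ⟨h0, h2⟩ := hα
  have hd' : (1:ℝ) ≤ d := by exact_mod_cast hd
  have hI := rhoA_integrable d α h0
  have hg := (((near_integrable d hd α h2).const_mul (2 * ((d:ℝ) + α) * ‖x‖)).add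
    (hI.comp_add_left x)).add (hI.comp_sub_left x)
  refine hg.mono' ?_ (Filter.Eventually.of_forall fun y => ?_)
  · have hc := (rhoA_cont d α).measurable
    refine Measurable.aestronglyMeasurable ?_
    have m1 : Measurable fun y : EuclideanSpace ℝ (Fin d) =>
        rhoA d α (x + y) - rhoA d α (x - y) :=
      (hc.comp (measurable_const_add x)).sub (hc.comp (measurable_const_sub x))
    have m2 : Measurable fun y : EuclideanSpace ℝ (Fin d) => ‖y‖ ^ (-(d : ℝ) - α) :=
      measurable_norm.pow_const _
    exact (m1.mul m2).smul measurable_id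
  · simp only [Pi.add_apply]
    have hp := rhoA_nonneg d α (x + y)
    have hm := rhoA_nonneg d α (x - y)
    rw [norm_smul, norm_mul, Real.norm_eq_abs, Real.norm_eq_abs,
      abs_of_nonneg (by positivity : 0 ≤ ‖y‖ ^ (-(d : ℝ) - α))]
    rcases eq_or_ne y 0 with rfl | hy
    · simp only [norm_zero, mul_zero]
      have : (0:ℝ) ∉ Set.Ioc (0:ℝ) 1 := by simp
      rw [Set.indicator_of_notMem this]; linarith
    have hy : 0 < ‖y‖ := norm_pos_iff.2 hy
    by_cases h1 : ‖y‖ ≤ 1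
    · have hmem : ‖y‖ ∈ Set.Ioc (0:ℝ) 1 := ⟨hy, h1⟩
      rw [Set.indicator_of_mem hmem]
      have hL : |rhoA d α (x + y) - rhoA d α (x - y)| ≤ 2 * ((d:ℝ) + α) * ‖x‖ * ‖y‖ := by
        have h := aux_lip (((d:ℝ) + α) / 2) (by positivity) (‖x + y‖ ^ 2) (‖x - y‖ ^ 2)
          (by positivity) (by positivity)
        rw [aux_diff, abs_mul] at h
        have h3 := abs_real_inner_le_norm x y
        have h4 : |(4:ℝ)| = 4 := by norm_num
        rw [h4] at h
        unfold rhoA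
        refine h.trans ?_
        have : ((d:ℝ) + α) * |⟪x, y⟫| ≤ ((d:ℝ) + α) * (‖x‖ * ‖y‖) := by gcongr
        nlinarith
      have he : ‖y‖ ^ (2 - (d:ℝ) - α) = ‖y‖ * ‖y‖ ^ (-(d : ℝ) - α) * ‖y‖ := by
        rw [show 2 - (d:ℝ) - α = 1 + (-(d : ℝ) - α) + 1 by ring, Real.rpow_add hy,
          Real.rpow_add hy, Real.rpow_one]
      rw [he]
      have : |rhoA d α (x + y) - rhoA d α (x - y)| * ‖y‖ ^ (-(d : ℝ) - α) * ‖y‖ ≤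
        (2 * ((d:ℝ) + α) * ‖x‖ * ‖y‖) * ‖y‖ ^ (-(d : ℝ) - α) * ‖y‖ := by gcongr
      linarith
    · have : ‖y‖ ∉ Set.Ioc (0:ℝ) 1 := fun h => h1 h.2
      rw [Set.indicator_of_notMem this]
      have he : ‖y‖ ^ (-(d : ℝ) - α) * ‖y‖ ≤ 1 := by
        have : ‖y‖ ^ (-(d : ℝ) - α) * ‖y‖ = ‖y‖ ^ (-(d : ℝ) - α + 1) := by
          rw [Real.rpow_add hy, Real.rpow_one]
        rw [this]
        exact Real.rpow_le_one_of_one_le_of_nonpos (by linarith) (by linarith)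
      have ha : |rhoA d α (x + y) - rhoA d α (x - y)| ≤ rhoA d α (x + y) + rhoA d α (x - y) := by
        rw [abs_le]; constructor <;> linarith
      have := mul_le_mul ha he (by positivity) (by linarith)
      linarith

/-- **Lemma 4.1(ii).** There is `κ₁ > 0` depending only on `d, α` such
that `⟨x, B(x)⟩ ≤ -κ₁ |x|^{2-d-α}` for all `|x| > 1`. -/
theorem stmt_13 (d : ℕ) (hd : 1 ≤ d) (α : ℝ) (hα : α ∈ Set.Ioo (0 : ℝ) 2) :
    ∃ κ₁ > (0 : ℝ), ∀ x : EuclideanSpace ℝ (Fin d), 1 < ‖x‖ →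
      ⟪x, fieldB d α x⟫ ≤ -κ₁ * ‖x‖ ^ (2 - (d : ℝ) - α) := by
  obtain ⟨h0, h2⟩ := id hα
  have hd' : (1:ℝ) ≤ d := by exact_mod_cast hd
  have hc : 0 < cdA d α := by
    unfold cdA
    have g1 := Real.Gamma_pos_of_pos (show 0 < ((d:ℝ) + α) / 2 by linarith)
    have g2 := Real.Gamma_pos_of_pos (show 0 < (d:ℝ) / 2 by linarith)
    have g3 := Real.Gamma_pos_of_pos (show 0 < (2 - α) / 2 by linarith)
    positivity
  set q := ((d:ℝ) + α) / 2 with hq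
  have hq0 : 0 < q := by rw [hq]; linarith
  set D : ℝ := (5 / 4 : ℝ) ^ (-q) - (13 / 4 : ℝ) ^ (-q) with hD
  have hDp : 0 < D := by
    have := Real.rpow_lt_rpow_of_neg (x := 5 / 4) (y := 13 / 4) (z := -q) (by norm_num)
      (by norm_num) (by linarith)
    rw [hD]; linarith
  set K : ℝ := D * (3 / 2 : ℝ) ^ (-(d:ℝ) - α) * (1 / 2) with hK
  have hKp : 0 < K := by positivity
  set V : ℝ := volume.real (Metric.ball (0 : EuclideanSpace ℝ (Fin d)) (1 / 2)) with hV
  have hVp : 0 < V := by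
    rw [hV, Measure.real]
    exact ENNReal.toReal_pos (Metric.measure_ball_pos _ _ (by norm_num)).ne'
      measure_ball_lt_top.ne
  refine ⟨cdA d α * (V * K), by positivity, fun x hx => ?_⟩
  have hint := main_integrable d hd α hα x
  have hVx : volume.real (Metric.ball x (1 / 2)) = V := by
    rw [hV, Measure.real, Measure.real, Measure.addHaar_ball_center]
  unfold fieldB
  rw [inner_smul_right, ← integral_inner hint]
  have hX : 0 < ‖x‖ := by linarith
  have key : ∫ y, ⟪x, ((rhoA d α (x + y) - rhoA d α (x - y)) * ‖y‖ ^ (-(d : ℝ) - α)) • y⟫ ≤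
      ∫ y, (Metric.ball x (1 / 2)).indicator (fun _ => -(K * ‖x‖ ^ (2 - (d:ℝ) - α))) y := by
    refine integral_mono (hint.const_inner x) ?_ ?_
    · exact (integrable_indicator_iff measurableSet_ball).2
        (integrableOn_const measure_ball_lt_top.ne)
    · intro y
      simp only [inner_smul_right]
      have hdf := aux_diff x y
      have hyp : 0 ≤ ‖y‖ ^ (-(d : ℝ) - α) := by positivity
      by_cases hy : y ∈ Metric.ball x (1 / 2)
      · rw [Set.indicator_of_mem hy]
        have hy' : ‖x - y‖ < 1 / 2 := by rwa [Metric.mem_ball', dist_eq_norm] at hy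
        have hxy : ‖x‖ ^ 2 * (1 / 2) ≤ ⟪x, y⟫ := by
          have e : ⟪x, y⟫ = ‖x‖ ^ 2 - ⟪x, x - y⟫ := by
            rw [inner_sub_right, real_inner_self_eq_norm_sq]; ring
          have := real_inner_le_norm x (x - y)
          rw [e]; nlinarith
        have hyn : ‖y‖ ≤ 3 / 2 * ‖x‖ := by
          have := norm_sub_norm_le y x
          rw [norm_sub_rev] at this; linarith
        have hy0 : 0 < ‖y‖ := by
          have := norm_sub_norm_le x y
          linarith
        have hpl : 3 / 2 ≤ ‖x + y‖ := by
          have h := norm_sub_norm_le ((2:ℝ) • x) (x - y)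
          rw [norm_smul, show (2:ℝ) • x - (x - y) = x + y by rw [two_smul]; abel] at h
          norm_num at h; linarith
        have r1 : (5 / 4 : ℝ) ^ (-q) ≤ rhoA d α (x - y) := by
          unfold rhoA
          refine Real.rpow_le_rpow_of_nonpos (by positivity) ?_ (by linarith)
          nlinarith [norm_nonneg (x - y)]
        have r2 : rhoA d α (x + y) ≤ (13 / 4 : ℝ) ^ (-q) := by
          unfold rhoA
          refine Real.rpow_le_rpow_of_nonpos (by positivity) ?_ (by linarith)
          nlinarith [norm_nonneg (x + y)]
        have r3 : (3 / 2 : ℝ) ^ (-(d:ℝ) - α) * ‖x‖ ^ (-(d:ℝ) - α) ≤ ‖y‖ ^ (-(d:ℝ) - α) := by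
          rw [← Real.mul_rpow (by norm_num) hX.le]
          exact Real.rpow_le_rpow_of_nonpos hy0 hyn (by linarith)
        have e : ‖x‖ ^ (2 - (d:ℝ) - α) = ‖x‖ ^ (-(d:ℝ) - α) * ‖x‖ ^ 2 := by
          rw [← Real.rpow_natCast, ← Real.rpow_add hX]; congr 1; push_cast; ring
        have r4 : D ≤ rhoA d α (x - y) - rhoA d α (x + y) := by rw [hD]; linarith
        have : D * ((3 / 2 : ℝ) ^ (-(d:ℝ) - α) * ‖x‖ ^ (-(d:ℝ) - α)) * (‖x‖ ^ 2 * (1 / 2)) ≤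
            (rhoA d α (x - y) - rhoA d α (x + y)) * ‖y‖ ^ (-(d:ℝ) - α) * ⟪x, y⟫ := by
          have r5 : 0 ≤ rhoA d α (x - y) - rhoA d α (x + y) := by linarith
          gcongr
        rw [e, hK]; linarith
      · rw [Set.indicator_of_notMem hy]
        rcases le_total 0 ⟪x, y⟫ with h | h
        · have := rhoA_mono (α := α) h0 (show ‖x - y‖ ^ 2 ≤ ‖x + y‖ ^ 2 by linarith)
          exact mul_nonpos_of_nonpos_of_nonneg
            (mul_nonpos_of_nonpos_of_nonneg (by linarith) hyp) h
        · have := rhoA_mono (α := α) h0 (show ‖x + y‖ ^ 2 ≤ ‖x - y‖ ^ 2 by linarith)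
          exact mul_nonpos_of_nonneg_of_nonpos (mul_nonneg (by linarith) hyp) h
  rw [integral_indicator_const _ measurableSet_ball, hVx, smul_eq_mul] at key
  have := mul_le_mul_of_nonneg_left key hc.le
  linarith
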